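/- Let κ₁ > 0 and assume the weak abc conjecture with exponent κ₁, namely: for every ε > 0 there are only finitely many primitive integer solutions (A,B,C) of A+B=C with ABC ≠ 0 and R(A,B,C) ≤ H(A,B,C)^{κ₁−ε}. Then for every ε > 0 there are only finitely many primitive integer solutions (X,Y,Z) of X+Y=Z with XYZ ≠ 0 satisfying S(X,Y,Z) ≤ (κ₁−ε)·log H(X,Y,Z). -/

import Mathlib

noncomputable section

/-- Height of a triple: `max(|X|,|Y|,|Z|)`. -/
def height (X Y Z : ℤ) : ℤ := max |X| (max |Y| |Z|)

/-- Smoothness of a triple: the largest prime dividing `X*Y*Z`. -/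
def smoothness (X Y Z : ℤ) : ℕ := sSup {p : ℕ | p.Prime ∧ (p : ℤ) ∣ X * Y * Z}

/-- Radical of a triple: the product of the primes dividing `X*Y*Z`. -/
def radical (X Y Z : ℤ) : ℕ := ∏ p ∈ (X * Y * Z).natAbs.primeFactors, p

/-- A primitive nondegenerate solution of the abc equation. -/
def IsPrimitiveSolution (X Y Z : ℤ) : Prop :=
  X + Y = Z ∧ X * Y * Z ≠ 0 ∧ Int.gcd X (Int.gcd Y Z) = 1

section PrimeNumberTheorem

open Filter Topology MeasureTheory Set

theorem integral_triangle_mul_cexp (t : ℝ) :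
    ∫ ξ in (-1 : ℝ)..1, ((1 - |ξ| : ℝ) : ℂ) * Complex.exp (ξ * t * Complex.I) =
      ((Real.sinc (t / 2) ^ 2 : ℝ) : ℂ) := by
  have h_int (a b : ℝ) : IntervalIntegrable
      (fun ξ : ℝ ↦ ((1 - |ξ| : ℝ) : ℂ) * Complex.exp (ξ * t * Complex.I)) volume a b :=
    Continuous.intervalIntegrable (by fun_prop) _ _
  rw [← intervalIntegral.integral_add_adjacent_intervals (h_int (-1) 0) (h_int 0 1)]
  have hneg : ∫ ξ in (-1 : ℝ)..0, ((1 - |ξ| : ℝ) : ℂ) * Complex.exp (ξ * t * Complex.I) =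
      ∫ ξ in (-1 : ℝ)..0, (1 + ξ : ℂ) * Complex.exp (ξ * t * Complex.I) := by
    refine intervalIntegral.integral_congr fun ξ hξ ↦ ?_
    rw [uIcc_of_le (by norm_num)] at hξ
    simp [abs_of_nonpos hξ.2]
  have hpos : ∫ ξ in (0 : ℝ)..1, ((1 - |ξ| : ℝ) : ℂ) * Complex.exp (ξ * t * Complex.I) =
      ∫ ξ in (0 : ℝ)..1, (1 - ξ : ℂ) * Complex.exp (ξ * t * Complex.I) := by
    refine intervalIntegral.integral_congr fun ξ hξ ↦ ?_
    rw [uIcc_of_le (by norm_num)] at hξ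
    simp [abs_of_nonneg hξ.1]
  rw [hneg, hpos]
  obtain ⟨c, hc⟩ : ∃ c : ℂ, c = t * Complex.I := ⟨_, rfl⟩
  have hexp (ξ : ℝ) : HasDerivAt (fun ξ : ℝ ↦ Complex.exp (ξ * c)) (Complex.exp (ξ * c) * c) ξ := by
    have := ((hasDerivAt_id (ξ : ℂ)).mul_const c).cexp.comp_ofReal
    simpa using this
  have hid (ξ : ℝ) : HasDerivAt (fun ξ : ℝ ↦ (ξ : ℂ)) 1 ξ := Complex.ofRealCLM.hasDerivAt
  simp_rw [mul_assoc, ← hc]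
  rcases eq_or_ne t 0 with rfl | ht
  · have hc0 : c = 0 := by simp [hc]
    rw [intervalIntegral.integral_eq_sub_of_hasDerivAt (f := fun ξ : ℝ ↦ (ξ : ℂ) + ξ ^ 2 / 2)
        (fun ξ _ ↦ ?_) (Continuous.intervalIntegrable (by fun_prop) _ _),
      intervalIntegral.integral_eq_sub_of_hasDerivAt (f := fun ξ : ℝ ↦ (ξ : ℂ) - ξ ^ 2 / 2)
        (fun ξ _ ↦ ?_) (Continuous.intervalIntegrable (by fun_prop) _ _)]
    · norm_num
    · convert! (hid ξ).sub (((hid ξ).pow 2).div_const 2) using 1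
      simp [hc0]
    · convert! (hid ξ).add (((hid ξ).pow 2).div_const 2) using 1
      simp [hc0]
  · have hc0 : c ≠ 0 := by simp [hc, ht]
    rw [intervalIntegral.integral_eq_sub_of_hasDerivAt
        (f := fun ξ : ℝ ↦ (1 + ξ) * Complex.exp (ξ * c) / c - Complex.exp (ξ * c) / c ^ 2)
        (fun ξ _ ↦ ?_) (Continuous.intervalIntegrable (by fun_prop) _ _),
      intervalIntegral.integral_eq_sub_of_hasDerivAt
        (f := fun ξ : ℝ ↦ (1 - ξ) * Complex.exp (ξ * c) / c + Complex.exp (ξ * c) / c ^ 2)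
        (fun ξ _ ↦ ?_) (Continuous.intervalIntegrable (by fun_prop) _ _)]
    · have hcos : Complex.exp c + Complex.exp (-c) = 2 - 4 * (Complex.sin (t / 2)) ^ 2 := by
        have h2 : Complex.cos t = 1 - 2 * Complex.sin (t / 2) ^ 2 := by
          rw [← Complex.cos_sq_add_sin_sq (t / 2 : ℂ)]
          have := Complex.cos_two_mul (t / 2 : ℂ)
          rw [mul_div_cancel₀ _ (two_ne_zero)] at this
          rw [this, ← Complex.cos_sq_add_sin_sq (t / 2 : ℂ)]
          ring
        have := Complex.two_cos (t : ℂ)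
        rw [hc, ← neg_mul, ← this, h2]
        ring
      have hc2 : c ^ 2 = -(t : ℂ) ^ 2 := by rw [hc, mul_pow, Complex.I_sq]; ring
      have htC : (t : ℂ) ≠ 0 := by exact_mod_cast ht
      rw [Real.sinc_of_ne_zero (by positivity)]
      push_cast
      have : Complex.exp (-c) = 2 - 4 * (Complex.sin (t / 2)) ^ 2 - Complex.exp c := by
        rw [← hcos]; ring
      simp only [neg_mul, one_mul, zero_mul, Complex.exp_zero, this, hc2]
      field_simp
      ring
    · convert! ((((hid ξ).const_sub 1).mul (hexp ξ)).div_const c).add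
        ((hexp ξ).div_const (c ^ 2)) using 1
      field_simp
      ring
    · convert! ((((hid ξ).const_add 1).mul (hexp ξ)).div_const c).sub
        ((hexp ξ).div_const (c ^ 2)) using 1
      field_simp
      ring

theorem integrable_sinc_half_sq : Integrable fun t : ℝ ↦ Real.sinc (t / 2) ^ 2 := by
  refine ((integrable_inv_one_add_sq).const_mul 8).mono'
    (by have := Real.continuous_sinc; fun_prop) (ae_of_all _ fun t ↦ ?_)
  rw [Real.norm_of_nonneg (sq_nonneg _), ← div_eq_mul_inv, le_div_iff₀ (by positivity)]
  have h1 : Real.sinc (t / 2) ^ 2 ≤ 1 := by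
    rw [sq_le_one_iff_abs_le_one]
    exact Real.abs_sinc_le_one _
  have h2 : Real.sinc (t / 2) ^ 2 * t ^ 2 ≤ 4 := by
    rcases eq_or_ne t 0 with rfl | ht
    · simp
    · rw [Real.sinc_of_ne_zero (by positivity), div_pow, div_pow]
      have := Real.sin_sq_le_one (t / 2)
      field_simp
      linarith
  linarith

theorem tendsto_integral_mul_sinc_sq {a : ℝ → ℝ} {C : ℝ} (ha : Measurable a)
    (haC : ∀ t, |a t| ≤ C) {F : ℂ → ℂ} (hF : ContinuousOn F {z | 0 ≤ z.re})
    (haF : ∀ z : ℂ, 0 < z.re → ∫ t in Ioi (0 : ℝ), (a t : ℂ) * Complex.exp (-z * t) = F z)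
    {L : ℝ} (hL : 0 < L) :
    Tendsto (fun y : ℝ ↦ ∫ t in Ioi (0 : ℝ), a t * Real.sinc (L * (y - t) / 2) ^ 2)
      atTop (𝓝 0) := by
  have hC : 0 ≤ C := (abs_nonneg _).trans (haC 0)
  have hsinc := Real.continuous_sinc
  have hfub (y : ℝ) {ε : ℝ} (hε : 0 < ε) :
      ∫ ξ in (-1 : ℝ)..1, ((1 - |ξ| : ℝ) : ℂ) * Complex.exp (ξ * L * y * Complex.I) *
        F (ε + ξ * L * Complex.I) =
      ((∫ t in Ioi (0 : ℝ),
        a t * Real.sinc (L * (y - t) / 2) ^ 2 * Real.exp (-ε * t) : ℝ) : ℂ) := by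
    have hF' (ξ : ℝ) : ((1 - |ξ| : ℝ) : ℂ) * Complex.exp (ξ * L * y * Complex.I) *
        F (ε + ξ * L * Complex.I) = ∫ t in Ioi (0 : ℝ),
          ((1 - |ξ| : ℝ) : ℂ) * Complex.exp (ξ * L * y * Complex.I) *
            (a t * Complex.exp (-(ε + ξ * L * Complex.I) * t)) := by
      rw [integral_const_mul, haF _ (by simpa using hε)]
    simp_rw [hF']
    rw [intervalIntegral_integral_swap, ← integral_complex_ofReal]
    · refine integral_congr_ae (ae_of_all _ fun t ↦ ?_)
      have := integral_triangle_mul_cexp (L * (y - t))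
      simp only [Complex.ofReal_mul, Complex.ofReal_exp] at this ⊢
      rw [← this, mul_right_comm, ← intervalIntegral.integral_const_mul]
      refine intervalIntegral.integral_congr fun ξ _ ↦ ?_
      have e : Complex.exp (ξ * L * y * Complex.I) * Complex.exp (-(ε + ξ * L * Complex.I) * t) =
          Complex.exp (ξ * (L * (y - t)) * Complex.I) * Complex.exp (-ε * t) := by
        rw [← Complex.exp_add, ← Complex.exp_add]; ring_nf
      push_cast
      linear_combination (1 - |ξ| : ℂ) * a t * e
    · have hexp : IntegrableOn (fun t : ℝ ↦ C * Real.exp (-ε * t)) (Ioi 0) :=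
        (integrableOn_exp_mul_Ioi (by linarith) 0).const_mul C
      have hone : Integrable (fun _ : ℝ ↦ (1 : ℝ)) (volume.restrict (uIoc (-1 : ℝ) 1)) := by
        rw [uIoc_of_le (by norm_num)]
        exact integrable_const _
      refine (hone.mul_prod hexp).mono' (by fun_prop) ?_
      rw [Measure.prod_restrict, ae_restrict_iff' (measurableSet_uIoc.prod measurableSet_Ioi)]
      refine ae_of_all _ fun ⟨ξ, t⟩ ⟨hξ, _⟩ ↦ ?_
      rw [uIoc_of_le (by norm_num)] at hξ
      have h1 : |(1 - |ξ|)| ≤ 1 := by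
        have := abs_le.2 ⟨hξ.1.le, hξ.2⟩
        rw [abs_of_nonneg (by linarith)]
        linarith [abs_nonneg ξ]
      simp only [Function.uncurry, norm_mul, Complex.norm_real, Real.norm_eq_abs, Complex.norm_exp]
      simp only [Complex.mul_re, Complex.mul_im, Complex.ofReal_re, Complex.ofReal_im,
        Complex.I_re, Complex.I_im, Complex.add_re, Complex.neg_re]
      simp only [mul_zero, sub_zero, zero_mul, mul_one, add_zero, Real.exp_zero]
      gcongr
      exact haC t
  have h_int (y : ℝ) : Integrable fun t ↦ Real.sinc (L * (y - t) / 2) ^ 2 :=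
    (integrable_sinc_half_sq.comp_mul_left' hL.ne').comp_sub_left y
  have hlim (y : ℝ) :
      ((∫ t in Ioi (0 : ℝ), a t * Real.sinc (L * (y - t) / 2) ^ 2 : ℝ) : ℂ) =
      ∫ ξ in (-1 : ℝ)..1, ((1 - |ξ| : ℝ) : ℂ) * Complex.exp (ξ * L * y * Complex.I) *
        F (ξ * L * Complex.I) := by
    have hl : Tendsto (fun ε : ℝ ↦ ((∫ t in Ioi (0 : ℝ),
        a t * Real.sinc (L * (y - t) / 2) ^ 2 * Real.exp (-ε * t) : ℝ) : ℂ)) (𝓝[>] 0)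
        (𝓝 ((∫ t in Ioi (0 : ℝ), a t * Real.sinc (L * (y - t) / 2) ^ 2 : ℝ) : ℂ)) := by
      refine (Complex.continuous_ofReal.tendsto _).comp ?_
      refine tendsto_integral_filter_of_dominated_convergence
        (fun t ↦ C * Real.sinc (L * (y - t) / 2) ^ 2) (Eventually.of_forall fun ε ↦ by fun_prop)
        ?_ ((h_int y).const_mul C).integrableOn (ae_of_all _ fun t ↦ ?_)
      · filter_upwards [self_mem_nhdsWithin] with ε hε
        rw [ae_restrict_iff' measurableSet_Ioi]
        refine ae_of_all _ fun t ht ↦ ?_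
        have he : Real.exp (-ε * t) ≤ 1 :=
          Real.exp_le_one_iff.2 (by have := mul_pos (mem_Ioi.1 hε) (mem_Ioi.1 ht); linarith)
        rw [norm_mul, norm_mul, Real.norm_eq_abs, Real.norm_of_nonneg (sq_nonneg _),
          Real.norm_of_nonneg (Real.exp_nonneg _)]
        calc _ ≤ C * Real.sinc (L * (y - t) / 2) ^ 2 * 1 := by gcongr; exact haC t
          _ = _ := mul_one _
      · have : Tendsto (fun ε : ℝ ↦ a t * Real.sinc (L * (y - t) / 2) ^ 2 * Real.exp (-ε * t))
            (𝓝 0) (𝓝 (a t * Real.sinc (L * (y - t) / 2) ^ 2 * Real.exp (-0 * t))) :=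
          Continuous.tendsto (by fun_prop) 0
        simpa using this.mono_left nhdsWithin_le_nhds
    refine tendsto_nhds_unique hl (Tendsto.congr' (f₁ := fun ε : ℝ ↦
      ∫ ξ in (-1 : ℝ)..1, ((1 - |ξ| : ℝ) : ℂ) * Complex.exp (ξ * L * y * Complex.I) *
        F (ε + ξ * L * Complex.I)) ?_ ?_)
    · filter_upwards [self_mem_nhdsWithin] with ε hε using hfub y hε
    have hcont : ContinuousOn (fun q : ℝ × ℝ ↦ F (q.1 + q.2 * L * Complex.I))
        (Icc 0 1 ×ˢ Icc (-1) 1) :=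
      hF.comp (by fun_prop) fun q hq ↦ by simpa using hq.1.1
    obtain ⟨M, hM⟩ := (isCompact_Icc.prod isCompact_Icc).exists_bound_of_continuousOn hcont
    have hev : ∀ᶠ ε : ℝ in 𝓝[>] 0, ε ∈ Icc (0 : ℝ) 1 := by
      filter_upwards [Ioo_mem_nhdsGT zero_lt_one] with ε hε using ⟨hε.1.le, hε.2.le⟩
    have hmem {ξ : ℝ} (hξ : ξ ∈ uIoc (-1 : ℝ) 1) : ξ ∈ Icc (-1 : ℝ) 1 := by
      rw [uIoc_of_le (by norm_num)] at hξ
      exact ⟨hξ.1.le, hξ.2⟩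
    refine intervalIntegral.tendsto_integral_filter_of_dominated_convergence (fun _ ↦ M) ?_ ?_
      intervalIntegrable_const (ae_of_all _ fun ξ hξ ↦ ?_)
    · filter_upwards [hev] with ε hε
      refine ContinuousOn.aestronglyMeasurable ?_ measurableSet_uIoc
      refine ContinuousOn.mul (by fun_prop) (hcont.comp (f := fun ξ : ℝ ↦ (ε, ξ)) (by fun_prop) ?_)
      exact fun ξ hξ ↦ ⟨hε, hmem hξ⟩
    · filter_upwards [hev] with ε hε
      refine ae_of_all _ fun ξ hξ ↦ ?_
      have h1 : |(1 - |ξ|)| ≤ 1 := by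
        have := abs_le.2 (hmem hξ)
        rw [abs_of_nonneg (by linarith)]
        linarith [abs_nonneg ξ]
      have h2 : ‖Complex.exp (ξ * L * y * Complex.I)‖ = 1 := by
        exact_mod_cast Complex.norm_exp_ofReal_mul_I (ξ * L * y)
      rw [norm_mul, norm_mul, h2, Complex.norm_real, Real.norm_eq_abs, mul_one]
      have h3 := hM (ε, ξ) ⟨hε, hmem hξ⟩
      calc _ ≤ 1 * M := by gcongr
        _ = M := one_mul M
    · refine Tendsto.const_mul _ ?_
      have h0 := (hcont (0, ξ) ⟨⟨le_rfl, zero_le_one⟩, hmem hξ⟩).tendsto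
      have h1 : Tendsto (fun ε : ℝ ↦ (ε, ξ)) (𝓝[>] 0) (𝓝[Icc 0 1 ×ˢ Icc (-1) 1] (0, ξ)) := by
        refine tendsto_nhdsWithin_iff.2 ⟨?_, hev.mono fun ε hε ↦ ⟨hε, hmem hξ⟩⟩
        exact (Continuous.tendsto (by fun_prop) (0 : ℝ)).mono_left nhdsWithin_le_nhds
      simpa [Function.comp_def] using h0.comp h1
  have hRL := (Real.tendsto_integral_exp_smul_cocompact ((Ioc (-1 : ℝ) 1).indicator fun ξ : ℝ ↦
    ((1 - |ξ| : ℝ) : ℂ) * F (ξ * L * Complex.I))).comp (tendsto_neg_atTop_atBot.comp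
      ((tendsto_id (α := ℝ) (x := atTop)).const_mul_atTop
        (show 0 < L / (2 * Real.pi) by positivity)) |>.mono_right atBot_le_cocompact)
  rw [← tendsto_ofReal_iff]
  convert! hRL using 2 with y
  · simp only [Function.comp]
    rw [hlim, intervalIntegral.integral_of_le (by norm_num), ← integral_indicator measurableSet_Ioc]
    congr 1 with ξ
    by_cases hξ : ξ ∈ Ioc (-1 : ℝ) 1
    · rw [indicator_of_mem hξ, indicator_of_mem hξ, Circle.smul_def, Real.fourierChar_apply]
      have : Complex.exp (ξ * L * y * Complex.I) =
          Complex.exp (((2 * Real.pi * -(ξ * -(L / (2 * Real.pi) * y)) : ℝ) : ℂ) * Complex.I) := by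
        congr 2
        push_cast
        have : (Real.pi : ℂ) ≠ 0 := by exact_mod_cast Real.pi_ne_zero
        field_simp
      rw [this, smul_eq_mul]
      simp only [id]
      ring
    · simp [hξ]

theorem eventually_le_one_add_of_tendsto_integral_mul_sinc_sq {b : ℝ → ℝ} {C : ℝ}
    (hb : Measurable b) (hb0 : ∀ t, 0 ≤ b t) (hbC : ∀ t, b t ≤ C)
    (hbexp : ∀ t h, 0 ≤ h → Real.exp (-h) * b t ≤ b (t + h))
    (hlim : ∀ L > 0, Tendsto (fun y : ℝ ↦ ∫ t in Ioi (0 : ℝ),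
      (b t - 1) * Real.sinc (L * (y - t) / 2) ^ 2) atTop (𝓝 0)) {δ : ℝ} (hδ : 0 < δ) :
    ∀ᶠ y in atTop, b y ≤ 1 + δ := by
  set K : ℝ → ℝ := fun t ↦ Real.sinc (t / 2) ^ 2 with hK
  have hKc : Continuous K := by have := Real.continuous_sinc; fun_prop
  have hK0 (t : ℝ) : 0 ≤ K t := sq_nonneg _
  have hKi : Integrable K := integrable_sinc_half_sq
  have hKpos : 0 < ∫ t, K t :=
    integral_pos_of_integrable_nonneg_nonzero (x := 0) hKc hKi hK0 (by simp [hK])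
  obtain ⟨N, hN, hN0⟩ : ∃ N : ℝ, ∫ t, K t < (1 + δ / 2) * ∫ t in (-N)..N, K t ∧ 0 < N := by
    have h1 := (intervalIntegral_tendsto_integral hKi tendsto_neg_atTop_atBot
      tendsto_id).const_mul (1 + δ / 2)
    have h2 : ∫ t, K t < (1 + δ / 2) * ∫ t, K t := by nlinarith
    exact ((h1.eventually_const_lt h2).and (eventually_gt_atTop 0)).exists
  set h : ℝ := δ / (4 * (1 + δ)) with hh
  have hh0 : 0 < h := by positivity
  set L : ℝ := N / h with hL
  have hL0 : 0 < L := by positivity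
  set c : ℝ := L⁻¹ * ((1 + δ / 2) * (∫ t in (-N)..N, K t) - ∫ t, K t) with hc
  have hc0 : 0 < c := mul_pos (inv_pos.2 hL0) (by linarith)
  have hev := (hlim L hL0).comp (tendsto_atTop_add_const_right atTop h tendsto_id)
  filter_upwards [hev.eventually_lt_const hc0, eventually_gt_atTop 0] with y hy hy0
  by_contra! hby
  refine hy.not_ge ?_
  simp only [Function.comp, id]
  have hKL : Integrable fun t ↦ K (L * (y + h - t)) :=
    (hKi.comp_mul_left' hL0.ne').comp_sub_left (y + h)
  have hlow (t : ℝ) : (Ioc y (y + 2 * h)).indicator (fun t ↦ (1 + δ / 2) * K (L * (y + h - t))) t -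
      K (L * (y + h - t)) ≤ (b t - 1) * K (L * (y + h - t)) := by
    have hk := hK0 (L * (y + h - t))
    by_cases ht : t ∈ Ioc y (y + 2 * h)
    · rw [indicator_of_mem ht]
      have h1 := hbexp y (t - y) (by linarith [ht.1])
      rw [add_sub_cancel] at h1
      have h2 : 1 - 2 * h ≤ Real.exp (-(t - y)) := by
        linarith [Real.add_one_le_exp (-(t - y)), ht.2]
      have h3 : (1 - 2 * h) * (1 + δ) = 1 + δ / 2 := by rw [hh]; field_simp; ring
      have h4 : 0 ≤ 1 - 2 * h := by
        by_contra! h5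
        nlinarith
      have h5 : 1 + δ / 2 ≤ b t := by
        rw [← h3]
        exact (mul_le_mul h2 hby.le (by positivity) (by positivity)).trans h1
      nlinarith
    · rw [indicator_of_notMem ht]
      nlinarith [mul_nonneg (hb0 t) hk]
  have hind : Integrable
      ((Ioc y (y + 2 * h)).indicator fun t ↦ (1 + δ / 2) * K (L * (y + h - t))) :=
    (hKL.const_mul _).indicator measurableSet_Ioc
  have hbK : Integrable fun t ↦ (b t - 1) * K (L * (y + h - t)) := by
    refine hKL.bdd_mul (c := C + 1) (by fun_prop) (ae_of_all _ fun t ↦ ?_)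
    rw [Real.norm_eq_abs, abs_le]
    constructor <;> linarith [hb0 t, hbC t]
  have hfull : ∫ t, K (L * (y + h - t)) = L⁻¹ * ∫ t, K t := by
    rw [integral_sub_left_eq_self (fun t ↦ K (L * t)), Measure.integral_comp_mul_left K L,
      abs_of_pos (inv_pos.2 hL0), smul_eq_mul]
  have hpart : ∫ t in Ioi (0 : ℝ), (Ioc y (y + 2 * h)).indicator
      (fun t ↦ (1 + δ / 2) * K (L * (y + h - t))) t =
      L⁻¹ * ((1 + δ / 2) * ∫ t in (-N)..N, K t) := by
    rw [setIntegral_indicator measurableSet_Ioc,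
      inter_eq_right.2 (Ioc_subset_Ioi_self.trans (Ioi_subset_Ioi hy0.le)), integral_const_mul,
      ← intervalIntegral.integral_of_le (by linarith)]
    have hLh : L * h = N := by rw [hL]; field_simp
    have := intervalIntegral.integral_comp_sub_mul (a := y) (b := y + 2 * h) K hL0.ne'
      (L * (y + h))
    rw [show L * (y + h) - L * (y + 2 * h) = -N by rw [← hLh]; ring,
      show L * (y + h) - L * y = N by rw [← hLh]; ring, smul_eq_mul] at this
    simp_rw [mul_sub L]
    rw [this]
    ring
  calc c = L⁻¹ * ((1 + δ / 2) * ∫ t in (-N)..N, K t) - ∫ t, K (L * (y + h - t)) := by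
        rw [hfull]; ring
    _ ≤ (∫ t in Ioi (0 : ℝ), (Ioc y (y + 2 * h)).indicator
          (fun t ↦ (1 + δ / 2) * K (L * (y + h - t))) t) -
          ∫ t in Ioi (0 : ℝ), K (L * (y + h - t)) := by
        rw [hpart]
        refine sub_le_sub_left ?_ _
        exact setIntegral_le_integral hKL (ae_of_all _ fun t ↦ hK0 _)
    _ = ∫ t in Ioi (0 : ℝ), ((Ioc y (y + 2 * h)).indicator
          (fun t ↦ (1 + δ / 2) * K (L * (y + h - t))) t - K (L * (y + h - t))) :=
        (integral_sub hind.integrableOn hKL.integrableOn).symm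
    _ ≤ _ := setIntegral_mono (hind.sub hKL).integrableOn hbK.integrableOn hlow

theorem integral_psi_exp_sub_one_mul_cexp {z : ℂ} (hz : 0 < z.re) :
    ∫ t in Ioi (0 : ℝ), ((Real.exp (-t) * Chebyshev.psi (Real.exp t) - 1 : ℝ) : ℂ) *
      Complex.exp (-z * t) =
    (ArithmeticFunction.vonMangoldt.LFunctionResidueClassAux (1 : ZMod 1) (1 + z) - 1) /
      (1 + z) := by
  have hz0 : z ≠ 0 := by rintro rfl; simp at hz
  have hz1 : 1 + z ≠ 0 := fun h ↦ by
    have := congrArg Complex.re h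
    simp at this
    linarith
  have hs : 1 < (1 + z).re := by simpa using hz
  have hres : ArithmeticFunction.vonMangoldt.residueClass (1 : ZMod 1) =
      fun n ↦ ArithmeticFunction.vonMangoldt n := by
    ext n
    exact indicator_of_mem (s := {n : ℕ | (n : ZMod 1) = 1}) (Subsingleton.elim _ _) _
  have hAux := ArithmeticFunction.vonMangoldt.eqOn_LFunctionResidueClassAux
    (isUnit_one (M := ZMod 1)) hs
  simp only [hres, Nat.totient_one, Nat.cast_one, inv_one, add_sub_cancel_left] at hAux
  have hpsi (x : ℝ) : ∑ n ∈ Finset.Icc 1 ⌊x⌋₊, ArithmeticFunction.vonMangoldt n =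
      Chebyshev.psi x := by
    simp [Chebyshev.psi, ← Finset.Icc_add_one_left_eq_Ioc]
  have hO : (fun n : ℕ ↦ ∑ k ∈ Finset.Icc 1 n, ArithmeticFunction.vonMangoldt k) =O[atTop]
      fun n ↦ (n : ℝ) ^ (1 : ℝ) := by
    refine Asymptotics.IsBigO.of_bound (Real.log 4 + 4) (Eventually.of_forall fun n ↦ ?_)
    have h1 := hpsi n
    rw [Nat.floor_natCast] at h1
    rw [h1, Real.rpow_one, Real.norm_of_nonneg (Chebyshev.psi_nonneg _), Real.norm_natCast]
    exact Chebyshev.psi_le_const_mul_self n.cast_nonneg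
  have hL := LSeries_eq_mul_integral_of_nonneg _ zero_le_one hs hO
    (fun n ↦ ArithmeticFunction.vonMangoldt_nonneg)
  have hpsiC (x : ℝ) : ∑ n ∈ Finset.Icc 1 ⌊x⌋₊, (ArithmeticFunction.vonMangoldt n : ℂ) =
      (Chebyshev.psi x : ℂ) := by
    rw [← hpsi]; push_cast; rfl
  simp_rw [hpsiC] at hL
  have hsub := integral_comp_exp_Ioi
    (fun x : ℝ ↦ (Chebyshev.psi x : ℂ) * (x : ℂ) ^ (-(1 + z + 1))) 0
  rw [Real.exp_zero] at hsub
  have hpt (t : ℝ) : Real.exp t • ((Chebyshev.psi (Real.exp t) : ℂ) *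
      ((Real.exp t : ℝ) : ℂ) ^ (-(1 + z + 1))) =
      ((Real.exp (-t) * Chebyshev.psi (Real.exp t) : ℝ) : ℂ) * Complex.exp (-z * t) := by
    rw [Complex.cpow_def_of_ne_zero (by exact_mod_cast (Real.exp_pos t).ne'),
      ← Complex.ofReal_log (Real.exp_pos t).le, Real.log_exp, Complex.real_smul]
    have : Complex.exp t * Complex.exp (t * -(1 + z + 1)) =
        Complex.exp (-t) * Complex.exp (-z * t) := by
      rw [← Complex.exp_add, ← Complex.exp_add]; ring_nf
    push_cast
    linear_combination (Chebyshev.psi (Real.exp t) : ℂ) * this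
  simp_rw [hpt] at hsub
  have hre : (-z).re < 0 := by simpa using hz
  have hexp : IntegrableOn (fun t : ℝ ↦ Complex.exp (-z * t)) (Ioi 0) :=
    integrableOn_exp_mul_complex_Ioi hre 0
  have h_int : IntegrableOn (fun t : ℝ ↦
      ((Real.exp (-t) * Chebyshev.psi (Real.exp t) : ℝ) : ℂ) * Complex.exp (-z * t)) (Ioi 0) := by
    have := Chebyshev.psi_mono.measurable
    refine hexp.bdd_mul (c := Real.log 4 + 4) (by fun_prop) (ae_of_all _ fun t ↦ ?_)
    rw [Complex.norm_real, Real.norm_of_nonneg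
      (mul_nonneg (Real.exp_nonneg _) (Chebyshev.psi_nonneg _)), Real.exp_neg,
      inv_mul_le_iff₀ (Real.exp_pos t), mul_comm]
    exact Chebyshev.psi_le_const_mul_self (Real.exp_nonneg t)
  simp_rw [Complex.ofReal_sub, sub_mul, Complex.ofReal_one, one_mul]
  rw [integral_sub h_int hexp, hsub, integral_exp_mul_complex_Ioi hre, hAux, hL]
  simp only [Complex.ofReal_zero, mul_zero, Complex.exp_zero]
  field_simp
  ring

theorem eventually_psi_le {δ : ℝ} (hδ : 0 < δ) :
    ∀ᶠ x in atTop, Chebyshev.psi x ≤ (1 + δ) * x := by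
  have hm := Chebyshev.psi_mono.measurable
  have hle (t : ℝ) : Real.exp (-t) * Chebyshev.psi (Real.exp t) ≤ Real.log 4 + 4 := by
    rw [Real.exp_neg, inv_mul_le_iff₀ (Real.exp_pos t), mul_comm]
    exact Chebyshev.psi_le_const_mul_self (Real.exp_nonneg t)
  have h0 (t : ℝ) : 0 ≤ Real.exp (-t) * Chebyshev.psi (Real.exp t) :=
    mul_nonneg (Real.exp_nonneg _) (Chebyshev.psi_nonneg _)
  have hF : ContinuousOn (fun z : ℂ ↦
      (ArithmeticFunction.vonMangoldt.LFunctionResidueClassAux (1 : ZMod 1) (1 + z) - 1) /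
        (1 + z)) {z | 0 ≤ z.re} := by
    refine (((ArithmeticFunction.vonMangoldt.continuousOn_LFunctionResidueClassAux
      (1 : ZMod 1)).comp (f := fun z : ℂ ↦ 1 + z) (by fun_prop) fun z hz ↦ ?_).sub
        continuousOn_const).div (by fun_prop) fun z hz h ↦ ?_
    · simpa using hz
    · have h1 := congrArg Complex.re h
      have h2 : 0 ≤ z.re := hz
      simp at h1
      linarith
  have hlog4 : 0 ≤ Real.log 4 := Real.log_nonneg (by norm_num)
  have key := eventually_le_one_add_of_tendsto_integral_mul_sinc_sq
    (b := fun t ↦ Real.exp (-t) * Chebyshev.psi (Real.exp t)) (by fun_prop) h0 hle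
    (fun t h hh ↦ ?_) (fun L hL ↦ tendsto_integral_mul_sinc_sq (C := Real.log 4 + 4)
      (by fun_prop) (fun t ↦ ?_) hF (fun z hz ↦ integral_psi_exp_sub_one_mul_cexp hz) hL) hδ
  · filter_upwards [Real.tendsto_log_atTop.eventually key, eventually_gt_atTop 0] with x hx hx0
    rwa [Real.exp_neg, Real.exp_log hx0, inv_mul_le_iff₀ hx0, mul_comm] at hx
  · rw [neg_add, Real.exp_add, mul_comm (Real.exp (-t)) (Real.exp (-h)), mul_assoc]
    gcongr
    linarith
  · rw [abs_le]
    constructor <;> linarith [h0 t, hle t]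

theorem exists_theta_le {δ : ℝ} (hδ : 0 < δ) :
    ∃ M, ∀ x, 0 ≤ x → Chebyshev.theta x ≤ (1 + δ) * x + M := by
  obtain ⟨x₀, hx₀⟩ := eventually_atTop.1 (eventually_psi_le hδ)
  refine ⟨Chebyshev.theta x₀, fun x hx ↦ ?_⟩
  rcases le_total x₀ x with h | h
  · linarith [hx₀ x h, Chebyshev.theta_le_psi x, Chebyshev.theta_nonneg x₀]
  · have := mul_nonneg (by linarith : 0 ≤ 1 + δ) hx
    linarith [Chebyshev.theta_mono h]

end PrimeNumberTheorem

theorem radical_pos(X Y Z : ℤ) : 0 < radical X Y Z :=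
  Finset.prod_pos fun _ hp ↦ (Nat.prime_of_mem_primeFactors hp).pos

theorem log_radical_le_theta_smoothness {X Y Z : ℤ} (h : X * Y * Z ≠ 0) :
    Real.log (radical X Y Z) ≤ Chebyshev.theta (smoothness X Y Z) := by
  rw [radical, Nat.cast_prod, Real.log_prod fun p hp ↦ by
    exact_mod_cast (Nat.prime_of_mem_primeFactors hp).ne_zero, Chebyshev.theta, Nat.floor_natCast]
  refine Finset.sum_le_sum_of_subset_of_nonneg (fun p hp ↦ ?_) fun p _ _ ↦ Real.log_natCast_nonneg p
  have hpp := Nat.prime_of_mem_primeFactors hp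
  have hbdd : BddAbove {p : ℕ | p.Prime ∧ (p : ℤ) ∣ X * Y * Z} :=
    ⟨(X * Y * Z).natAbs, fun q hq ↦
      Nat.le_of_dvd (Int.natAbs_pos.2 h) (Int.natCast_dvd.1 hq.2)⟩
  rw [Finset.mem_filter, Finset.mem_Ioc]
  exact ⟨⟨hpp.pos, le_csSup hbdd
    ⟨hpp, Int.natCast_dvd.2 (Nat.dvd_of_mem_primeFactors hp)⟩⟩, hpp⟩

theorem one_le_height {X Y Z : ℤ} (h : X * Y * Z ≠ 0) : 1 ≤ height X Y Z :=
  (Int.one_le_abs fun hX ↦ h (by simp [hX])).trans (le_max_left _ _)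

theorem finite_setOf_height_le (B : ℝ) :
    {T : ℤ × ℤ × ℤ | (height T.1 T.2.1 T.2.2 : ℝ) ≤ B}.Finite := by
  have hI := Set.finite_Icc (-⌊B⌋) ⌊B⌋
  refine (hI.prod (hI.prod hI)).subset fun T hT ↦ ?_
  have hT' : height T.1 T.2.1 T.2.2 ≤ ⌊B⌋ := Int.le_floor.2 hT
  simp only [height, max_le_iff, abs_le] at hT'
  exact ⟨hT'.1, hT'.2.1, hT'.2.2⟩

theorem abc_implies_xyz_lower_bound (κ₁ : ℝ) (hκ₁ : 0 < κ₁)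
    (habc : ∀ ε > 0, {T : ℤ × ℤ × ℤ | IsPrimitiveSolution T.1 T.2.1 T.2.2 ∧
      (radical T.1 T.2.1 T.2.2 : ℝ) ≤
        (height T.1 T.2.1 T.2.2 : ℝ) ^ (κ₁ - ε)}.Finite) :
    ∀ ε > 0, {T : ℤ × ℤ × ℤ | IsPrimitiveSolution T.1 T.2.1 T.2.2 ∧
      (smoothness T.1 T.2.1 T.2.2 : ℝ) ≤
        (κ₁ - ε) * Real.log (height T.1 T.2.1 T.2.2)}.Finite := by
  intro ε hε
  obtain ⟨η, hη, hηε, hηκ⟩ : ∃ η > 0, η ≤ ε ∧ η < κ₁ :=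
    ⟨min ε (κ₁ / 2), by positivity, min_le_left _ _, (min_le_right _ _).trans_lt (by linarith)⟩
  obtain ⟨M, hM⟩ := exists_theta_le (δ := η / (2 * κ₁)) (by positivity)
  refine ((habc (η / 4) (by positivity)).union
    (finite_setOf_height_le (Real.exp (4 * M / η)))).subset ?_
  rintro ⟨X, Y, Z⟩ ⟨hsol, hS⟩
  by_cases hsmall : (height X Y Z : ℝ) ≤ Real.exp (4 * M / η)
  · exact Or.inr hsmall
  refine Or.inl ⟨hsol, ?_⟩
  dsimp only at hS hsol ⊢
  have hH : (1 : ℝ) ≤ height X Y Z := by exact_mod_cast one_le_height hsol.2.1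
  have hlog : 0 ≤ Real.log (height X Y Z) := Real.log_nonneg hH
  have hMlog : M ≤ η / 4 * Real.log (height X Y Z) := by
    have := (Real.lt_log_iff_exp_lt (by linarith)).2 (not_le.1 hsmall)
    rw [div_lt_iff₀ hη] at this
    linarith
  have hS' : (smoothness X Y Z : ℝ) ≤ (κ₁ - η) * Real.log (height X Y Z) :=
    hS.trans (by gcongr)
  have hcoef : (1 + η / (2 * κ₁)) * (κ₁ - η) ≤ κ₁ - η / 2 := by
    have : (1 + η / (2 * κ₁)) * (κ₁ - η) = κ₁ - η / 2 - η ^ 2 / (2 * κ₁) := by field_simp; ring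
    rw [this]
    linarith [show 0 ≤ η ^ 2 / (2 * κ₁) by positivity]
  rw [Real.le_rpow_iff_log_le (by exact_mod_cast radical_pos X Y Z) (by linarith)]
  calc Real.log (radical X Y Z) ≤ Chebyshev.theta (smoothness X Y Z) :=
        log_radical_le_theta_smoothness hsol.2.1
    _ ≤ (1 + η / (2 * κ₁)) * smoothness X Y Z + M := hM _ (Nat.cast_nonneg _)
    _ ≤ (1 + η / (2 * κ₁)) * ((κ₁ - η) * Real.log (height X Y Z)) +
          η / 4 * Real.log (height X Y Z) := by gcongr
    _ = ((1 + η / (2 * κ₁)) * (κ₁ - η)) * Real.log (height X Y Z) +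
          η / 4 * Real.log (height X Y Z) := by ring
    _ ≤ (κ₁ - η / 2) * Real.log (height X Y Z) + η / 4 * Real.log (height X Y Z) := by gcongr
    _ = (κ₁ - η / 4) * Real.log (height X Y Z) := by ring
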